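/- Let U ∈ 𝔖_F(𝕊_1^+) with F ∈ L^∞(𝕊_1^+). Then for every r ∈ (0,1) such that H(U,r) > 0, one has 1 + N(U,r) ≥ 0, where N(U,r) = 2 I(U,r)/H(U,r). -/

import Mathlib

/- Formalization of results from "The structure of the singular set in the thin obstacle
problem for degenerate parabolic equations" by Banerjee, Danielli, Garofalo, Petrosyan.

Points of ℝ^{n+1} are written X = (x,y) with x : Fin n → ℝ and y : ℝ; functions of
space-time are `U : (Fin n → ℝ) → ℝ → ℝ → ℝ`, with `U x y t`. -/

noncomputable section

open MeasureTheory Filter Topology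

/-- Functions on ℝⁿ × ℝ × ℝ, written `U x y t` for `X = (x,y)` and time `t`. -/
abbrev Fn (n : ℕ) := (Fin n → ℝ) → ℝ → ℝ → ℝ

/-- Space-time points `(x, y, t)`. -/
abbrev Pt (n : ℕ) := (Fin n → ℝ) × ℝ × ℝ

/-- Partial derivative in the direction of the i-th thin coordinate. -/
def pdx {n : ℕ} (i : Fin n) (U : Fn n) (x : Fin n → ℝ) (y t : ℝ) : ℝ :=
  fderiv ℝ (fun x' => U x' y t) x (Pi.single i 1)

/-- Partial derivative in the extension variable y. -/
def pdy {n : ℕ} (U : Fn n) (x : Fin n → ℝ) (y t : ℝ) : ℝ :=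
  deriv (fun y' => U x y' t) y

/-- Time derivative. -/
def pdt {n : ℕ} (U : Fn n) (x : Fin n → ℝ) (y t : ℝ) : ℝ :=
  deriv (fun t' => U x y t') t

/-- Squared norm |∇U|² of the full spatial gradient. -/
def gradSq {n : ℕ} (U : Fn n) (x : Fin n → ℝ) (y t : ℝ) : ℝ :=
  (∑ i, (pdx i U x y t) ^ 2) + (pdy U x y t) ^ 2

/-- |∇V − ∇W|². -/
def gradDiffSq {n : ℕ} (V W : Fn n) (x : Fin n → ℝ) (y t : ℝ) : ℝ :=
  (∑ i, (pdx i V x y t - pdx i W x y t) ^ 2) + (pdy V x y t - pdy W x y t) ^ 2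

/-- The generator Z f = ⟨X, ∇f⟩ + 2 t ∂ₜ f of the parabolic dilations. -/
def Zop {n : ℕ} (U : Fn n) (x : Fin n → ℝ) (y t : ℝ) : ℝ :=
  (∑ i, x i * pdx i U x y t) + y * pdy U x y t + 2 * t * pdt U x y t

/-- Laplacian in the x variables only. -/
def lapx {n : ℕ} (U : Fn n) (x : Fin n → ℝ) (y t : ℝ) : ℝ :=
  ∑ i, pdx i (fun x' y' t' => pdx i U x' y' t') x y t

/-- Second derivative in y. -/
def pdyy {n : ℕ} (U : Fn n) (x : Fin n → ℝ) (y t : ℝ) : ℝ :=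
  pdy (fun x' y' t' => pdy U x' y' t') x y t

/-- Full spatial Laplacian in the variables X = (x,y). -/
def lapFull {n : ℕ} (U : Fn n) (x : Fin n → ℝ) (y t : ℝ) : ℝ :=
  lapx U x y t + pdyy U x y t

/-- |X|² for X = (x,y). -/
def nsq {n : ℕ} (x : Fin n → ℝ) (y : ℝ) : ℝ := (∑ i, (x i) ^ 2) + y ^ 2

/-- The backward Neumann fundamental solution Ḡ_a(X,t), for t < 0. -/
def Gbar (n : ℕ) (a : ℝ) (x : Fin n → ℝ) (y t : ℝ) : ℝ :=
  (4 * Real.pi) ^ (-(n : ℝ) / 2) / ((2:ℝ) ^ a * Real.Gamma ((a + 1) / 2)) *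
    |t| ^ (-((n : ℝ) + a + 1) / 2) * Real.exp (-(nsq x y) / (4 * |t|))

/-- The half-strip 𝕊_r⁺ = ℝ^{n+1}_+ × (−r², 0]. -/
def Splus (n : ℕ) (r : ℝ) : Set (Pt n) :=
  {p | 0 < p.2.1 ∧ p.2.2 ∈ Set.Ioc (-(r ^ 2)) 0}

/-- The Gaussian weight Ḡ_a(X,t) yᵃ. -/
def wgt (n : ℕ) (a : ℝ) (p : Pt n) : ℝ :=
  Gbar n a p.1 p.2.1 p.2.2 * p.2.1 ^ a

/-- The height function H(U,r). -/
def Hfn (n : ℕ) (a : ℝ) (U : Fn n) (r : ℝ) : ℝ :=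
  (1 / r ^ 2) * ∫ p in Splus n r, (U p.1 p.2.1 p.2.2) ^ 2 * wgt n a p

/-- The energy D(U,r). -/
def Dfn (n : ℕ) (a : ℝ) (U : Fn n) (r : ℝ) : ℝ :=
  (1 / r ^ 2) * ∫ p in Splus n r, |p.2.2| * gradSq U p.1 p.2.1 p.2.2 * wgt n a p

/-- The total energy I(U,r). -/
def Ifn (n : ℕ) (a : ℝ) (U : Fn n) (r : ℝ) : ℝ :=
  (1 / (2 * r ^ 2)) * ∫ p in Splus n r, U p.1 p.2.1 p.2.2 * Zop U p.1 p.2.1 p.2.2 * wgt n a p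

/-- The set of thin points in S₁ where both U and its weighted normal derivative
∂_yᵃ U vanish.  The extended free boundary Γ_*(U) is its boundary in S₁. -/
def ZeroSet (n : ℕ) (a : ℝ) (U : Fn n) : Set ((Fin n → ℝ) × ℝ) :=
  {q | q.2 ∈ Set.Ioc (-1 : ℝ) 0 ∧ U q.1 0 q.2 = 0 ∧
    Tendsto (fun y => y ^ a * pdy U q.1 y q.2) (𝓝[>] (0 : ℝ)) (𝓝 0)}

/-- The Signorini class 𝔖_F(𝕊₁⁺). -/
structure SignoriniMem (n : ℕ) (a : ℝ) (F U : Fn n) : Prop where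
  /-- continuity up to the thin space -/
  cont : ContinuousOn (fun p : Pt n => U p.1 p.2.1 p.2.2)
    {p : Pt n | 0 ≤ p.2.1 ∧ p.2.2 ∈ Set.Ioc (-1 : ℝ) 0}
  /-- bounded support in the space variables -/
  bddSupp : ∃ R > (0:ℝ), ∀ x y t, R ^ 2 ≤ nsq x y → U x y t = 0
  /-- smoothness in {y > 0} -/
  smooth : ∀ x y t, 0 < y → t ∈ Set.Ioc (-1 : ℝ) 0 →
    ContDiffAt ℝ (⊤ : ℕ∞) (fun p : Pt n => U p.1 p.2.1 p.2.2) (x, y, t)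
  /-- the equation yᵃ ∂ₜU = div(yᵃ ∇U) + yᵃ F holds classically in {y > 0} -/
  pde : ∀ x y t, 0 < y → t ∈ Set.Ioc (-1 : ℝ) 0 →
    pdt U x y t = lapFull U x y t + (a / y) * pdy U x y t + F x y t
  /-- ∇ₓU extends parabolically Hölder continuously up to {y = 0} -/
  holderX : ∃ α > (0:ℝ), ∃ C : ℝ, ∀ i : Fin n, ∀ x y t x' y' t',
    0 < y → 0 < y' → t ∈ Set.Ioc (-1 : ℝ) 0 → t' ∈ Set.Ioc (-1 : ℝ) 0 →
    |pdx i U x y t - pdx i U x' y' t'| ≤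
      C * ((∑ j, (x j - x' j) ^ 2) + (y - y') ^ 2 + |t - t'|) ^ (α / 2)
  /-- yᵃ ∂_y U extends parabolically Hölder continuously up to {y = 0} -/
  holderY : ∃ α > (0:ℝ), ∃ C : ℝ, ∀ x y t x' y' t',
    0 < y → 0 < y' → t ∈ Set.Ioc (-1 : ℝ) 0 → t' ∈ Set.Ioc (-1 : ℝ) 0 →
    |y ^ a * pdy U x y t - y' ^ a * pdy U x' y' t'| ≤
      C * ((∑ j, (x j - x' j) ^ 2) + (y - y') ^ 2 + |t - t'|) ^ (α / 2)
  /-- ∂ₜU ∈ L^∞(𝕊₁⁺) -/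
  bddTime : ∃ M : ℝ, ∀ x y t, 0 < y → t ∈ Set.Ioc (-1 : ℝ) 0 → |pdt U x y t| ≤ M
  /-- yᵃ |∇ ∂ₓᵢ U|² integrable on 𝕊₁⁺ -/
  intXX : ∀ i : Fin n, IntegrableOn
    (fun p : Pt n => p.2.1 ^ a * gradSq (fun x y t => pdx i U x y t) p.1 p.2.1 p.2.2)
    (Splus n 1)
  /-- y^{−a} (∂_y(yᵃ ∂_y U))² integrable on 𝕊₁⁺ -/
  intYY : IntegrableOn
    (fun p : Pt n => p.2.1 ^ (-a) *
      (pdy (fun x y t => y ^ a * pdy U x y t) p.1 p.2.1 p.2.2) ^ 2) (Splus n 1)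
  /-- U ≥ 0 on the thin space -/
  nonneg : ∀ x, ∀ t ∈ Set.Ioc (-1 : ℝ) 0, 0 ≤ U x 0 t
  /-- the Signorini complementarity conditions on the thin space -/
  signorini : ∀ x, ∀ t ∈ Set.Ioc (-1 : ℝ) 0, ∃ L ≤ (0:ℝ),
    Tendsto (fun y => y ^ a * pdy U x y t) (𝓝[>] (0 : ℝ)) (𝓝 L) ∧ U x 0 t * L = 0
  /-- (0,0) belongs to the extended free boundary Γ_*(U) -/
  originFB : (0, 0) ∈ closure (ZeroSet n a U) ∧
    (0, 0) ∈ closure ({q : (Fin n → ℝ) × ℝ | q.2 ∈ Set.Ioc (-1 : ℝ) 0} \ ZeroSet n a U)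

/-- The growth bound |F(X,t)| ≤ C_ℓ |(X,t)|^{ℓ−2} on 𝕊₁⁺. -/
def FGrowth (n : ℕ) (F : Fn n) (l Cl : ℝ) : Prop :=
  ∀ x y t, 0 < y → t ∈ Set.Ioc (-1 : ℝ) 0 →
    |F x y t| ≤ Cl * (nsq x y + |t|) ^ ((l - 2) / 2)

/-- The growth bound |∇_X F(X,t)| ≤ C_ℓ |(X,t)|^{ℓ−3} on 𝔹_{1/2}⁺ × (−1/4, 0]. -/
def FGradGrowth (n : ℕ) (F : Fn n) (l Cl : ℝ) : Prop :=
  ∀ x y t, 0 < y → nsq x y < (1/2 : ℝ) ^ 2 → t ∈ Set.Ioc (-(1/4 : ℝ)) 0 →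
    Real.sqrt (gradSq F x y t) ≤ Cl * (nsq x y + |t|) ^ ((l - 3) / 2)

/-- The growth bound |∂ₜF(X,t)| ≤ C_ℓ |(X,t)|^{ℓ−4} on 𝔹_{1/2}⁺ × (−1/4, 0]. -/
def FTimeGrowth (n : ℕ) (F : Fn n) (l Cl : ℝ) : Prop :=
  ∀ x y t, 0 < y → nsq x y < (1/2 : ℝ) ^ 2 → t ∈ Set.Ioc (-(1/4 : ℝ)) 0 →
    |pdt F x y t| ≤ Cl * (nsq x y + |t|) ^ ((l - 4) / 2)

/-- r ↦ log max{H(U,r), r^{2ℓ−2+2σ}}. -/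
def logMaxH (n : ℕ) (a : ℝ) (U : Fn n) (l σ : ℝ) (r : ℝ) : ℝ :=
  Real.log (max (Hfn n a U r) (r ^ (2 * l - 2 + 2 * σ)))

/-- The set of radii in (0,1) where `logMaxH` is differentiable (it is locally
Lipschitz, hence this set has full measure). -/
def diffSet (n : ℕ) (a : ℝ) (U : Fn n) (l σ : ℝ) : Set ℝ :=
  {r | r ∈ Set.Ioo (0 : ℝ) 1 ∧ DifferentiableAt ℝ (logMaxH n a U l σ) r}

/-- The truncated Almgren–Poon frequency Φ_{ℓ,σ}(U,·), with constant C. -/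
def Phi (n : ℕ) (a : ℝ) (U : Fn n) (l σ C : ℝ) (r : ℝ) : ℝ :=
  (1/2) * r * Real.exp (C * r ^ (1 - σ)) * deriv (logMaxH n a U l σ) r
    + 2 * (Real.exp (C * r ^ (1 - σ)) - 1)

/-- The parabolic Almgren rescalings U_r. -/
def rescale (n : ℕ) (a : ℝ) (U : Fn n) (r : ℝ) : Fn n :=
  fun x y t => U (r • x) (r * y) (r ^ 2 * t) / Real.sqrt (Hfn n a U r)

/-- The Weiss functional 𝒲_κ(U,r). -/
def Wfn (n : ℕ) (a : ℝ) (U : Fn n) (κ r : ℝ) : ℝ :=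
  r ^ (-(2 * κ)) * (Dfn n a U r - κ / 2 * Hfn n a U r)

/-- The Monneau functional M_κ(U,p_κ,r). -/
def Mfn (n : ℕ) (a : ℝ) (U pk : Fn n) (κ r : ℝ) : ℝ :=
  r ^ (-(2 * κ + 2)) *
    ∫ p in Splus n r, (U p.1 p.2.1 p.2.2 - pk p.1 p.2.1 p.2.2) ^ 2 * wgt n a p

/-- Polynomial functions of (x,t). -/
def IsPolyFun2 (n : ℕ) (q : (Fin n → ℝ) → ℝ → ℝ) : Prop :=
  ∃ P : MvPolynomial (Fin (n + 1)) ℝ, ∀ x t, q x t = MvPolynomial.eval (Fin.snoc x t) P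

/-- Polynomial functions of (x,y,t). -/
def IsPolyFun3 (n : ℕ) (q : Fn n) : Prop :=
  ∃ P : MvPolynomial (Fin (n + 2)) ℝ, ∀ x y t,
    q x y t = MvPolynomial.eval (Fin.snoc (Fin.snoc x y) t) P

/-- The class 𝒫_κ⁺ of parabolically κ-homogeneous, even in y, a-caloric polynomials
which are nonnegative on the thin space. -/
def Pkappa (n : ℕ) (a κ : ℝ) (p : Fn n) : Prop :=
  IsPolyFun3 n p ∧
  (∀ lam > (0:ℝ), ∀ x y t, p (lam • x) (lam * y) (lam ^ 2 * t) = lam ^ κ * p x y t) ∧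
  (∀ x y t, p x (-y) t = p x y t) ∧
  (∀ x t, 0 ≤ p x 0 t) ∧
  (∀ x y t, y ≠ 0 →
    pdt p x y t - lapx p x y t - pdyy p x y t - (a / y) * pdy p x y t = 0)

/-- The coincidence set Λ(U) ⊆ S₁. -/
def Lam (n : ℕ) (U : Fn n) : Set ((Fin n → ℝ) × ℝ) :=
  {q | q.2 ∈ Set.Ioc (-1 : ℝ) 0 ∧ U q.1 0 q.2 = 0}

/-- The thin parabolic cylinder Q_r = B_r × (−r²,0]. -/
def Qthin (n : ℕ) (r : ℝ) : Set ((Fin n → ℝ) × ℝ) :=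
  {q | (∑ i, (q.1 i) ^ 2) < r ^ 2 ∧ q.2 ∈ Set.Ioc (-(r ^ 2)) 0}

/-- The modified Bessel function of the first kind I_ν(z). -/
def besselI (ν z : ℝ) : ℝ :=
  ∑' k : ℕ, (z / 2) ^ (ν + 2 * (k : ℝ)) /
    (Real.Gamma ((k : ℝ) + 1) * Real.Gamma ((k : ℝ) + ν + 1))

/-- The Bessel heat kernel p^{(a)}(y,η,t). -/
def pker (a y η t : ℝ) : ℝ :=
  (2 * t) ^ (-(a + 1) / 2) * (y * η / (2 * t)) ^ ((1 - a) / 2) *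
    besselI ((a - 1) / 2) (y * η / (2 * t)) * Real.exp (-(y ^ 2 + η ^ 2) / (4 * t))


section NondegeneracyProof

/-- Parabolic change of variables on slices: rescaling each time slice `t` by `√(-t)`. -/
lemma parabolic_change_of_variables {E : Type*} [NormedAddCommGroup E] [NormedSpace ℝ E]
    [FiniteDimensional ℝ E] [MeasurableSpace E] [BorelSpace E] (μ : Measure E)
    [μ.IsAddHaarMeasure] [SFinite μ] {T : Set ℝ} (hT : MeasurableSet T) (hneg : ∀ t ∈ T, t < 0)
    {f k : E × ℝ → ℝ} (hf : Integrable f (μ.prod (volume.restrict T)))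
    (hk : AEStronglyMeasurable k (μ.prod (volume.restrict T)))
    (hfk : ∀ e, ∀ t ∈ T,
      k (e, t) = Real.sqrt (-t) ^ Module.finrank ℝ E * f (Real.sqrt (-t) • e, t)) :
    ∫ z, f z ∂(μ.prod (volume.restrict T)) = ∫ e, (∫ t in T, k (e, t)) ∂μ := by
  have hpos : ∀ t ∈ T, 0 < Real.sqrt (-t) := fun t ht =>
    Real.sqrt_pos.2 (neg_pos.2 (hneg t ht))
  have hslice : ∀ t ∈ T, ∀ φ : E → ℝ,
      ∫ e, Real.sqrt (-t) ^ Module.finrank ℝ E * φ (Real.sqrt (-t) • e) ∂μ = ∫ e, φ e ∂μ := by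
    intro t ht φ
    have h := hpos t ht
    rw [integral_const_mul, Measure.integral_comp_smul_of_nonneg μ φ _ (hR := h.le), smul_eq_mul,
      ← mul_assoc, mul_inv_cancel₀ (by positivity), one_mul]
  have hfi := (integrable_prod_iff' hf.aestronglyMeasurable).1 hf
  have hki : Integrable k (μ.prod (volume.restrict T)) := by
    rw [integrable_prod_iff' hk]
    constructor
    · filter_upwards [hfi.1, ae_restrict_mem hT] with t ht htT
      have : (fun e => k (e, t)) = fun e =>
          Real.sqrt (-t) ^ Module.finrank ℝ E * f (Real.sqrt (-t) • e, t) :=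
        funext fun e => hfk e t htT
      rw [this]
      exact (ht.comp_smul (hpos t htT).ne').const_mul _
    · refine hfi.2.congr ?_
      filter_upwards [ae_restrict_mem hT] with t htT
      rw [← hslice t htT fun e => ‖f (e, t)‖]
      refine integral_congr_ae (Eventually.of_forall fun e => ?_)
      have h := hpos t htT
      simp only [hfk e t htT, norm_mul, norm_pow, Real.norm_of_nonneg h.le]
  rw [integral_prod_symm f hf, ← integral_prod k hki, integral_prod_symm k hki]
  refine integral_congr_ae ?_
  filter_upwards [ae_restrict_mem hT] with t htT
  rw [← hslice t htT fun e => f (e, t)]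
  exact integral_congr_ae (Eventually.of_forall fun e => (hfk e t htT).symm)

/-- The generator of the parabolic dilations as a full derivative along `(x, y, 2t)`. -/
lemma Zop_eq_fderiv {n : ℕ} {U : Fn n} {x : Fin n → ℝ} {y t : ℝ}
    (h : DifferentiableAt ℝ (fun p : Pt n => U p.1 p.2.1 p.2.2) (x, y, t)) :
    Zop U x y t = fderiv ℝ (fun p : Pt n => U p.1 p.2.1 p.2.2) (x, y, t) (x, y, 2 * t) := by
  set D := fderiv ℝ (fun p : Pt n => U p.1 p.2.1 p.2.2) (x, y, t) with hD
  have hd : HasFDerivAt (fun p : Pt n => U p.1 p.2.1 p.2.2) D (x, y, t) := h.hasFDerivAt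
  have hx : ∀ i, pdx i U x y t = D (Pi.single i 1, 0, 0) := by
    intro i
    have h1 : HasFDerivAt (fun x' : Fin n → ℝ => ((x', y, t) : Pt n))
        (ContinuousLinearMap.inl ℝ (Fin n → ℝ) (ℝ × ℝ)) x := hasFDerivAt_prodMk_left x (y, t)
    have h2 := HasFDerivAt.comp x hd h1
    have h3 : HasFDerivAt (fun x' => U x' y t) _ x := h2
    rw [pdx, h3.fderiv]
    rfl
  have hy : pdy U x y t = D (0, 1, 0) := by
    have h1 : HasDerivAt (fun y' : ℝ => ((x, y', t) : Pt n)) (0, 1, 0) y :=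
      (hasDerivAt_const y x).prodMk ((hasDerivAt_id y).prodMk (hasDerivAt_const y t))
    have h3 : HasDerivAt (fun y' => U x y' t) _ y :=
      HasFDerivAt.comp_hasDerivAt (f := fun y' => ((x, y', t) : Pt n)) y hd h1
    exact h3.deriv
  have ht : pdt U x y t = D (0, 0, 1) := by
    have h1 : HasDerivAt (fun t' : ℝ => ((x, y, t') : Pt n)) (0, 0, 1) t :=
      (hasDerivAt_const t x).prodMk ((hasDerivAt_const t y).prodMk (hasDerivAt_id t))
    have h3 : HasDerivAt (fun t' => U x y t') _ t :=
      HasFDerivAt.comp_hasDerivAt (f := fun t' => ((x, y, t') : Pt n)) t hd h1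
    exact h3.deriv
  have hv : ((x, y, 2 * t) : Pt n) = (∑ i, x i • ((Pi.single i 1, 0, 0) : Pt n))
      + y • ((0, 1, 0) : Pt n) + (2 * t) • ((0, 0, 1) : Pt n) := by
    have hs : (∑ i, x i • ((Pi.single i 1, 0, 0) : Pt n)) = (x, 0, 0) := by
      have := congrArg (ContinuousLinearMap.inl ℝ (Fin n → ℝ) (ℝ × ℝ))
        (pi_eq_sum_univ' x).symm
      rw [map_sum] at this
      refine Eq.trans (Finset.sum_congr rfl fun i _ => ?_) this
      simp
    rw [hs]
    simp
  rw [hv, map_add, map_add, map_sum]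
  simp only [map_smul, smul_eq_mul, Zop, hx, hy, ht]

/-- The integrand of `r² (H + 2 I)`, without the weight. -/
def energyDensity {n : ℕ} (U : Fn n) (p : Pt n) : ℝ :=
  (U p.1 p.2.1 p.2.2) ^ 2 + U p.1 p.2.1 p.2.2 * Zop U p.1 p.2.1 p.2.2

/-- The curve `t ↦ (√(-t) x, √(-t) y, t)`, an orbit of the parabolic dilations. -/
def orbit {n : ℕ} (e : (Fin n → ℝ) × ℝ) (t : ℝ) : Pt n :=
  (Real.sqrt (-t) • e.1, Real.sqrt (-t) * e.2, t)

variable {n : ℕ} {a : ℝ} {F U : Fn n}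

lemma SignoriniMem.continuousOn_energyDensity (hU : SignoriniMem n a F U) :
    ContinuousOn (energyDensity U) (Splus n 1) := by
  have hmem : ∀ p ∈ Splus n 1, ContDiffAt ℝ (⊤ : ℕ∞) (fun p : Pt n => U p.1 p.2.1 p.2.2) p := by
    rintro ⟨x, y, t⟩ ⟨hy, ht⟩
    exact hU.smooth x y t hy (by simpa using ht)
  have hc : ContinuousOn (fun p : Pt n => U p.1 p.2.1 p.2.2) (Splus n 1) := fun p hp =>
    (hmem p hp).continuousAt.continuousWithinAt
  have hZ : ContinuousOn (fun p : Pt n => Zop U p.1 p.2.1 p.2.2) (Splus n 1) := by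
    have : ContinuousOn (fun p : Pt n => fderiv ℝ (fun p : Pt n => U p.1 p.2.1 p.2.2) p
        (p.1, p.2.1, 2 * p.2.2)) (Splus n 1) := by
      refine ContinuousOn.clm_apply (fun p hp => ?_) (by fun_prop)
      exact ((hmem p hp).continuousAt_fderiv (by simp)).continuousWithinAt
    refine this.congr fun p hp => ?_
    exact Zop_eq_fderiv ((hmem p hp).differentiableAt (by simp))
  exact (hc.pow 2).add (hc.mul hZ)

/-- Along each dilation orbit the energy density is the derivative of `t U²`. -/
lemma SignoriniMem.integral_energyDensity_orbit_nonneg (hU : SignoriniMem n a F U) {r : ℝ}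
    (hr : r ∈ Set.Ioo (0 : ℝ) 1) {e : (Fin n → ℝ) × ℝ} (he : 0 < e.2) :
    0 ≤ ∫ t in Set.Ioo (-(r ^ 2)) 0, energyDensity U (orbit e t) := by
  obtain ⟨hr0, hr1⟩ := hr
  have hr2 : r ^ 2 < 1 := by nlinarith
  by_cases hint : IntegrableOn (fun t => energyDensity U (orbit e t)) (Set.Ioo (-(r ^ 2)) 0)
  swap
  · rw [integral_undef hint]
  have hle : -(r ^ 2) ≤ 0 := by nlinarith
  let u : ℝ → ℝ := fun t => U (orbit e t).1 (orbit e t).2.1 (orbit e t).2.2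
  have hu : ContinuousOn u (Set.Icc (-(r ^ 2)) 0) := by
    refine ContinuousOn.comp hU.cont (f := orbit e) ?_ ?_
    · unfold orbit
      fun_prop
    · intro t ht
      have ht1 : -1 < t := by linarith [ht.1]
      exact ⟨mul_nonneg (Real.sqrt_nonneg _) he.le, ht1, ht.2⟩
  have hderiv : ∀ t ∈ Set.Ioo (-(r ^ 2)) 0,
      HasDerivAt (fun t => t * u t ^ 2) (energyDensity U (orbit e t)) t := by
    intro t ht
    have hs : 0 < Real.sqrt (-t) := Real.sqrt_pos.2 (neg_pos.2 ht.2)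
    have hsq : Real.sqrt (-t) * Real.sqrt (-t) = -t := Real.mul_self_sqrt (by linarith [ht.2])
    have hsmooth := (hU.smooth (orbit e t).1 (orbit e t).2.1 t (mul_pos hs he)
      ⟨by linarith [ht.1], ht.2.le⟩).differentiableAt (by simp)
    have hσ : HasDerivAt (fun t => Real.sqrt (-t)) (-1 / (2 * Real.sqrt (-t))) t := by
      simpa using (hasDerivAt_neg t).sqrt (by linarith [ht.2])
    have horb : HasDerivAt (orbit e) ((-1 / (2 * Real.sqrt (-t))) • e.1,
        (-1 / (2 * Real.sqrt (-t))) * e.2, 1) t :=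
      (hσ.smul_const e.1).prodMk ((hσ.mul_const e.2).prodMk (hasDerivAt_id t))
    have hu' : HasDerivAt u _ t :=
      HasFDerivAt.comp_hasDerivAt t (f := orbit e) hsmooth.hasFDerivAt horb
    have hZ : Zop U (orbit e t).1 (orbit e t).2.1 (orbit e t).2.2 =
        2 * t * fderiv ℝ (fun p : Pt n => U p.1 p.2.1 p.2.2) ((orbit e t).1, (orbit e t).2.1, t)
          ((-1 / (2 * Real.sqrt (-t))) • e.1, (-1 / (2 * Real.sqrt (-t))) * e.2, 1) := by
      rw [← smul_eq_mul (2 * t), ← map_smul]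
      refine (Zop_eq_fderiv hsmooth).trans (congrArg _ ?_)
      have hc : 2 * t * (-1 / (2 * Real.sqrt (-t))) = Real.sqrt (-t) := by
        field_simp
        linarith
      simp only [orbit, Prod.smul_mk, smul_smul, smul_eq_mul, hc, mul_one, ← mul_assoc]
    refine ((hasDerivAt_id t).mul (hu'.pow 2)).congr_deriv ?_
    rw [energyDensity, hZ]
    simp only [u, id, Pi.pow_apply]
    push_cast
    ring
  have hii : IntervalIntegrable (fun t => energyDensity U (orbit e t)) volume (-(r ^ 2)) 0 :=
    (intervalIntegrable_iff_integrableOn_Ioo_of_le hle).2 hint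
  have := intervalIntegral.integral_eq_sub_of_hasDerivAt_of_le hle
    (continuousOn_id.mul (hu.pow 2)) hderiv hii
  rw [← integral_Ioc_eq_integral_Ioo, ← intervalIntegral.integral_of_le hle, this]
  simp only [id, Pi.mul_apply, Pi.pow_apply, zero_mul, zero_sub, neg_mul, neg_neg]
  positivity

lemma wgt_nonneg (ha : -1 < a) {p : Pt n} (hp : 0 < p.2.1) : 0 ≤ wgt n a p := by
  have : 0 < Real.Gamma ((a + 1) / 2) := Real.Gamma_pos_of_pos (by linarith)
  unfold wgt Gbar
  positivity

/-- Parabolic homogeneity of the Gaussian weight. -/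
lemma wgt_orbit {e : (Fin n → ℝ) × ℝ} (he : 0 < e.2) {t : ℝ} (ht : t < 0) :
    Real.sqrt (-t) ^ (n + 1) * wgt n a (orbit e t) = wgt n a (e.1, e.2, -1) := by
  have hs : 0 < Real.sqrt (-t) := Real.sqrt_pos.2 (neg_pos.2 ht)
  set σ := Real.sqrt (-t) with hσ
  have hsq : |t| = σ ^ (2 : ℝ) := by
    rw [abs_of_neg ht, hσ, Real.rpow_two, Real.sq_sqrt (by linarith)]
  have hn : nsq (σ • e.1) (σ * e.2) = σ ^ 2 * nsq e.1 e.2 := by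
    simp only [nsq, Pi.smul_apply, smul_eq_mul, mul_pow, ← Finset.mul_sum]
    ring
  have hexp : -(σ ^ 2 * nsq e.1 e.2) / (4 * σ ^ (2 : ℝ)) = -nsq e.1 e.2 / (4 * |-1|) := by
    rw [Real.rpow_two, abs_neg, abs_one]
    field_simp
  have hpow : σ ^ (n + 1) * (σ ^ (2 : ℝ)) ^ (-((n : ℝ) + a + 1) / 2) * σ ^ a = 1 := by
    rw [← Real.rpow_natCast, ← Real.rpow_mul hs.le, ← Real.rpow_add hs, ← Real.rpow_add hs]
    convert Real.rpow_zero σ using 2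
    push_cast
    ring
  simp only [wgt, Gbar, orbit, ← hσ, hn, hsq, hexp, Real.mul_rpow hs.le he.le, abs_neg, abs_one,
    Real.one_rpow]
  linear_combination ((4 * Real.pi) ^ (-(n : ℝ) / 2) / ((2:ℝ) ^ a * Real.Gamma ((a + 1) / 2)) *
    Real.exp (-nsq e.1 e.2 / (4 * 1)) * e.2 ^ a) * hpow

/-- Up to a null set, `𝕊_r⁺` is the product of the open half-space and a time interval. -/
lemma measurePreserving_prodAssoc_Splus (n : ℕ) (r : ℝ) :
    MeasurePreserving (MeasurableEquiv.prodAssoc (α := Fin n → ℝ) (β := ℝ) (γ := ℝ))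
      (((volume : Measure ((Fin n → ℝ) × ℝ)).prod
        (volume.restrict (Set.Ioo (-(r ^ 2)) 0))).restrict ({e | 0 < e.2} ×ˢ Set.univ))
      (volume.restrict (Splus n r)) := by
  have hmeas : MeasurableSet {p : Pt n | 0 < p.2.1 ∧ p.2.2 ∈ Set.Ioo (-(r ^ 2)) 0} :=
    (measurableSet_lt measurable_const
      (by fun_prop : Measurable fun p : Pt n => p.2.1)).inter
      (measurableSet_Ioo.preimage (by fun_prop : Measurable fun p : Pt n => p.2.2))
  have hae : Splus n r =ᵐ[volume] {p : Pt n | 0 < p.2.1 ∧ p.2.2 ∈ Set.Ioo (-(r ^ 2)) 0} := by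
    have hq : Measure.QuasiMeasurePreserving (fun p : Pt n => p.2.2) volume volume :=
      Measure.quasiMeasurePreserving_snd.comp Measure.quasiMeasurePreserving_snd
    have h0 : ∀ᵐ p : Pt n, p.2.2 ≠ 0 := hq.ae (Measure.ae_ne volume 0)
    filter_upwards [h0] with p hp
    refine propext ⟨fun h => ⟨h.1, h.2.1, lt_of_le_of_ne h.2.2 hp⟩,
      fun h => ⟨h.1, h.2.1, h.2.2.le⟩⟩
  have h := (volume_preserving_prodAssoc (α₁ := Fin n → ℝ) (β₁ := ℝ)
    (γ₁ := ℝ)).restrict_preimage hmeas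
  rw [Measure.restrict_congr_set hae]
  have hprod : (((volume : Measure ((Fin n → ℝ) × ℝ)).prod
      (volume.restrict (Set.Ioo (-(r ^ 2)) 0))).restrict ({e | 0 < e.2} ×ˢ Set.univ))
      = (volume.prod volume).restrict ({e | 0 < e.2} ×ˢ Set.Ioo (-(r ^ 2)) 0) := by
    rw [← Measure.prod_restrict, ← Measure.prod_restrict, Measure.restrict_univ]
  rw [hprod]
  exact h

/-- The energy `r² (H + 2 I)` is nonnegative. -/
lemma SignoriniMem.integral_energyDensity_nonneg (hU : SignoriniMem n a F U) (ha : -1 < a) {r : ℝ}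
    (hr : r ∈ Set.Ioo (0 : ℝ) 1)
    (hint : IntegrableOn (fun p => energyDensity U p * wgt n a p) (Splus n r)) :
    0 ≤ ∫ p in Splus n r, energyDensity U p * wgt n a p := by
  have hr2 : r ^ 2 < 1 := by nlinarith [hr.1, hr.2]
  have hmp := measurePreserving_prodAssoc_Splus n r
  set A : Set ((Fin n → ℝ) × ℝ) := {e | 0 < e.2} with hA
  set T : Set ℝ := Set.Ioo (-(r ^ 2)) 0 with hT
  have hAm : MeasurableSet A := measurableSet_lt measurable_const measurable_snd
  have hATm : MeasurableSet (A ×ˢ (Set.univ : Set ℝ)) := hAm.prod MeasurableSet.univ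
  let φ : ((Fin n → ℝ) × ℝ) × ℝ → ℝ := fun z =>
    energyDensity U (z.1.1, z.1.2, z.2) * wgt n a (z.1.1, z.1.2, z.2)
  let f := (A ×ˢ (Set.univ : Set ℝ)).indicator φ
  let ψ : ((Fin n → ℝ) × ℝ) × ℝ → ℝ := fun z =>
    energyDensity U (orbit z.1 z.2) * wgt n a (z.1.1, z.1.2, -1)
  let k := (A ×ˢ (Set.univ : Set ℝ)).indicator ψ
  have hf : Integrable f (volume.prod (volume.restrict T)) :=
    (integrable_indicator_iff hATm).2
      ((hmp.integrable_comp_emb MeasurableEquiv.prodAssoc.measurableEmbedding).2 hint)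
  have hk : AEStronglyMeasurable k (volume.prod (volume.restrict T)) := by
    rw [aestronglyMeasurable_indicator_iff hATm]
    have hprod : (((volume : Measure ((Fin n → ℝ) × ℝ)).prod (volume.restrict T)).restrict
        (A ×ˢ Set.univ)) = (volume.prod volume).restrict (A ×ˢ T) := by
      rw [← Measure.prod_restrict, ← Measure.prod_restrict, Measure.restrict_univ]
    rw [hprod]
    refine ContinuousOn.aestronglyMeasurable ?_ (hAm.prod measurableSet_Ioo)
    refine ContinuousOn.mul ?_ ?_
    · refine hU.continuousOn_energyDensity.comp 
        (f := fun z : ((Fin n → ℝ) × ℝ) × ℝ => orbit z.1 z.2) ?_ ?_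
      · unfold orbit
        fun_prop
      · rintro ⟨e, t⟩ ⟨he, ht⟩
        have ht1 : -1 < t := by linarith [ht.1]
        exact ⟨mul_pos (Real.sqrt_pos.2 (neg_pos.2 ht.2)) he, by simpa [orbit] using ht1, ht.2.le⟩
    · have hpow : ContinuousOn (fun z : ((Fin n → ℝ) × ℝ) × ℝ => z.1.2 ^ a) (A ×ˢ T) :=
        ContinuousOn.rpow_const (by fun_prop) fun z hz => Or.inl (ne_of_gt hz.1)
      refine ContinuousOn.mul (Continuous.continuousOn ?_) hpow
      unfold Gbar nsq
      simp only [abs_neg, abs_one]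
      exact Continuous.mul continuous_const (by fun_prop)
  have hfk : ∀ e, ∀ t ∈ T, k (e, t) = Real.sqrt (-t) ^
      Module.finrank ℝ ((Fin n → ℝ) × ℝ) * f (Real.sqrt (-t) • e, t) := by
    intro e t ht
    have hs : 0 < Real.sqrt (-t) := Real.sqrt_pos.2 (neg_pos.2 ht.2)
    have hdim : Module.finrank ℝ ((Fin n → ℝ) × ℝ) = n + 1 := by simp
    rw [hdim]
    by_cases he : 0 < e.2
    · have h1 : (e, t) ∈ A ×ˢ (Set.univ : Set ℝ) := ⟨he, trivial⟩
      have h2 : (Real.sqrt (-t) • e, t) ∈ A ×ˢ (Set.univ : Set ℝ) := ⟨mul_pos hs he, trivial⟩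
      simp only [k, f, Set.indicator_of_mem h1, Set.indicator_of_mem h2]
      simp only [ψ, ← wgt_orbit he ht.2]
      change _ = _ * (energyDensity U (orbit e t) * wgt n a (orbit e t))
      ring
    · have h1 : (e, t) ∉ A ×ˢ (Set.univ : Set ℝ) := fun h => he h.1
      have h2 : (Real.sqrt (-t) • e, t) ∉ A ×ˢ (Set.univ : Set ℝ) := fun h =>
        he (pos_of_mul_pos_right h.1 hs.le)
      simp only [k, f, Set.indicator_of_notMem h1, Set.indicator_of_notMem h2, mul_zero]
  have : (volume : Measure ((Fin n → ℝ) × ℝ)).IsAddHaarMeasure :=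
    Measure.prod.instIsAddHaarMeasure _ _
  have hmain := parabolic_change_of_variables volume measurableSet_Ioo
    (fun t (ht : t ∈ T) => ht.2) hf hk hfk
  have hintf : ∫ p in Splus n r, energyDensity U p * wgt n a p
      = ∫ z, f z ∂(volume.prod (volume.restrict T)) := by
    rw [integral_indicator hATm]
    exact (hmp.integral_comp MeasurableEquiv.prodAssoc.measurableEmbedding _).symm
  rw [hintf, hmain]
  refine integral_nonneg fun e => ?_
  by_cases he : 0 < e.2
  · have h1 : ∀ t, k (e, t) = energyDensity U (orbit e t) * wgt n a (e.1, e.2, -1) := fun t =>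
      Set.indicator_of_mem (show (e, t) ∈ A ×ˢ (Set.univ : Set ℝ) from ⟨he, trivial⟩) ψ
    simp only [h1, integral_mul_const]
    exact mul_nonneg (hU.integral_energyDensity_orbit_nonneg hr he) (wgt_nonneg ha he)
  · have h1 : ∀ t, k (e, t) = 0 := fun t =>
      Set.indicator_of_notMem (show (e, t) ∉ A ×ˢ (Set.univ : Set ℝ) from fun h => he h.1) ψ
    simp [h1]

end NondegeneracyProof

/-- nondegeneracy 1 + N(U,r) ≥ 0 whenever H(U,r) > 0. -/
theorem frequency_nondegeneracy (n : ℕ) (hn : 1 ≤ n) (a : ℝ) (ha₁ : -1 < a) (ha₂ : a < 1)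
    (F U : Fn n) (hU : SignoriniMem n a F U)
    (hF : ∃ M : ℝ, ∀ x y t, 0 < y → t ∈ Set.Ioc (-1 : ℝ) 0 → |F x y t| ≤ M)
    (r : ℝ) (hr : r ∈ Set.Ioo (0 : ℝ) 1) (hH : 0 < Hfn n a U r) :
    0 ≤ 1 + 2 * Ifn n a U r / Hfn n a U r := by
  obtain ⟨hr0, hr1⟩ := hr
  have hHint : IntegrableOn (fun p : Pt n => (U p.1 p.2.1 p.2.2) ^ 2 * wgt n a p) (Splus n r) := by
    by_contra h
    rw [Hfn, integral_undef h, mul_zero] at hH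
    exact lt_irrefl _ hH
  by_cases hIint : IntegrableOn (fun p : Pt n =>
      U p.1 p.2.1 p.2.2 * Zop U p.1 p.2.1 p.2.2 * wgt n a p) (Splus n r)
  swap
  · rw [Ifn, integral_undef hIint]
    simp
  have hsplit : (fun p => energyDensity U p * wgt n a p) = fun p : Pt n =>
      (U p.1 p.2.1 p.2.2) ^ 2 * wgt n a p
        + U p.1 p.2.1 p.2.2 * Zop U p.1 p.2.1 p.2.2 * wgt n a p :=
    funext fun p => add_mul _ _ _
  have hnonneg := hU.integral_energyDensity_nonneg ha₁ ⟨hr0, hr1⟩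
    (hsplit ▸ hHint.add hIint)
  rw [hsplit, integral_add hHint hIint] at hnonneg
  have hsum : Hfn n a U r + 2 * Ifn n a U r = (1 / r ^ 2) *
      ((∫ p in Splus n r, (U p.1 p.2.1 p.2.2) ^ 2 * wgt n a p)
        + ∫ p in Splus n r, U p.1 p.2.1 p.2.2 * Zop U p.1 p.2.1 p.2.2 * wgt n a p) := by
    rw [Hfn, Ifn]
    field_simp
  have hfrac : 1 + 2 * Ifn n a U r / Hfn n a U r
      = (Hfn n a U r + 2 * Ifn n a U r) / Hfn n a U r := by
    field_simp
  rw [hfrac, hsum]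
  positivity
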